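/- Let f ∈ Lip(1,1), and let (a_{n,k}) be a lower triangular matrix with a_{n,k} ≥ 0 for k ≤ n, a_{n,k} = 0 for k > n, and ∑_{k=0}^n a_{n,k} = 1 for all n. If for some β > 0 the sequences ((k+1)^{−β} a_{n,k})_{k=0}^n belong to HBVS with a constant independent of n, and (n+1)a_{n,n} = O(1), then ‖T_n(f) − f‖_{L^1} = O(n^{−1}). -/

import Mathlib

open MeasureTheory Finset Real

/-- The Dirichlet kernel `D_n(u) = 1/2 + ∑_{k=1}^n cos(k u)`. -/
noncomputable def dirichletKernel (n : ℕ) (u : ℝ) : ℝ :=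
  1 / 2 + ∑ k ∈ Finset.Icc 1 n, Real.cos (k * u)

/-- The `n`-th partial sum of the Fourier series of a `2π`-periodic function `f`,
`S_n(f;x) = (1/π) ∫_0^{2π} f(t) D_n(x - t) dt`. -/
noncomputable def partialFourierSum (f : ℝ → ℝ) (n : ℕ) (x : ℝ) : ℝ :=
  (1 / Real.pi) * ∫ t in (0 : ℝ)..(2 * Real.pi), f t * dirichletKernel n (x - t)

/-- The normalized `L^p` norm `‖f‖_{L^p} = ((1/2π) ∫_0^{2π} |f(x)|^p dx)^{1/p}`. -/
noncomputable def lpNorm (p : ℝ) (f : ℝ → ℝ) : ℝ :=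
  ((1 / (2 * Real.pi)) * ∫ x in (0 : ℝ)..(2 * Real.pi), |f x| ^ p) ^ (1 / p)

/-- The integral modulus of continuity
`ω_p(f;δ) = sup_{0<|h|≤δ} ((1/2π) ∫_0^{2π} |f(x+h) - f(x)|^p dx)^{1/p}`. -/
noncomputable def intModulus (p : ℝ) (f : ℝ → ℝ) (δ : ℝ) : ℝ :=
  sSup {y : ℝ | ∃ h : ℝ, 0 < |h| ∧ |h| ≤ δ ∧
    y = ((1 / (2 * Real.pi)) * ∫ x in (0 : ℝ)..(2 * Real.pi), |f (x + h) - f x| ^ p) ^ (1 / p)}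

/-- `f ∈ Lip(α,p)`: `f` is `2π`-periodic, belongs to `L^p[0,2π]`, and
`ω_p(f;δ) = O(δ^α)`. -/
def LipClass (α p : ℝ) (f : ℝ → ℝ) : Prop :=
  Function.Periodic f (2 * Real.pi) ∧
  IntervalIntegrable f MeasureTheory.volume 0 (2 * Real.pi) ∧
  IntervalIntegrable (fun x => |f x| ^ p) MeasureTheory.volume 0 (2 * Real.pi) ∧
  ∃ C : ℝ, 0 < C ∧ ∀ δ : ℝ, 0 < δ → intModulus p f δ ≤ C * δ ^ α

/-- The matrix transform `T_n(f;x) = ∑_{k=0}^n a_{n,k} S_k(f;x)`. -/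
noncomputable def matrixMeans (a : ℕ → ℕ → ℝ) (f : ℝ → ℝ) (n : ℕ) (x : ℝ) : ℝ :=
  ∑ k ∈ Finset.range (n + 1), a n k * partialFourierSum f k x

/-- `A_{n,m} = (1/(m+1)) ∑_{k=0}^m a_{n,k}`, the Cesàro mean of the `n`-th row. -/
noncomputable def rowMean (a : ℕ → ℕ → ℝ) (n m : ℕ) : ℝ :=
  (1 / ((m : ℝ) + 1)) * ∑ k ∈ Finset.range (m + 1), a n k

/-- The Riesz means `R_n(f;x) = (1/P_n) ∑_{k=0}^n p_k S_k(f;x)` with weights `w`. -/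
noncomputable def rieszMeans (w : ℕ → ℝ) (f : ℝ → ℝ) (n : ℕ) (x : ℝ) : ℝ :=
  (1 / (∑ k ∈ Finset.range (n + 1), w k)) *
    ∑ k ∈ Finset.range (n + 1), w k * partialFourierSum f k x

/-- The kernel `K_n(u) = ∑_{k=0}^n a_{n,k} sin((k+1/2)u)/(2 sin(u/2))`. -/
noncomputable def matrixKernel (a : ℕ → ℕ → ℝ) (n : ℕ) (u : ℝ) : ℝ :=
  ∑ k ∈ Finset.range (n + 1),
    a n k * (Real.sin (((k : ℝ) + 1 / 2) * u) / (2 * Real.sin (u / 2)))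

/-! ### The remainder kernels -/

/-- The sawtooth `(π - t) / 2` minus the `k`-th partial sum of its Fourier series on `(0, 2π)`. -/
noncomputable def sawtoothRemainder (k : ℕ) (t : ℝ) : ℝ :=
  (π - t) / 2 - ∑ j ∈ Finset.Icc 1 k, Real.sin (j * t) / j

/-- The sums `∑_{k ≤ l} (2k+1) r_k` of the sawtooth remainders `r_k`. -/
noncomputable def weightedRemainder (l : ℕ) (t : ℝ) : ℝ :=
  ∑ k ∈ Finset.range (l + 1), (2 * (k : ℝ) + 1) * sawtoothRemainder k t

lemma continuous_dirichletKernel (k : ℕ) : Continuous (dirichletKernel k) := by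
  unfold dirichletKernel; fun_prop

lemma continuous_sawtoothRemainder (k : ℕ) : Continuous (sawtoothRemainder k) := by
  unfold sawtoothRemainder; fun_prop

lemma continuous_weightedRemainder (l : ℕ) : Continuous (weightedRemainder l) := by
  unfold weightedRemainder
  exact continuous_finsetSum _ fun k _ => continuous_const.mul (continuous_sawtoothRemainder k)

lemma hasDerivAt_sawtoothRemainder (k : ℕ) (t : ℝ) :
    HasDerivAt (sawtoothRemainder k) (-dirichletKernel k t) t := by
  have h2 : HasDerivAt (fun t : ℝ => ∑ j ∈ Finset.Icc 1 k, Real.sin (j * t) / j)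
      (∑ j ∈ Finset.Icc 1 k, Real.cos (j * t)) t := by
    apply HasDerivAt.fun_sum
    intro j hj
    have hj0 : (j : ℝ) ≠ 0 := by
      have := (Finset.mem_Icc.1 hj).1
      positivity
    have h := (((hasDerivAt_id t).const_mul (j : ℝ)).sin).div_const (j : ℝ)
    refine h.congr_deriv ?_
    simp only [id]
    field_simp
  have h1 : HasDerivAt (fun t : ℝ => (π - t) / 2) (-1 / 2) t :=
    ((hasDerivAt_id t).const_sub π).div_const 2
  refine (h1.sub h2).congr_deriv ?_
  unfold dirichletKernel
  ring

lemma two_sin_mul_dirichletKernel (k : ℕ) (t : ℝ) :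
    2 * Real.sin (t / 2) * dirichletKernel k t = Real.sin ((k + 1 / 2) * t) := by
  induction k with
  | zero =>
    simp only [dirichletKernel, Nat.cast_zero]
    norm_num
    ring_nf
  | succ k ih =>
    have h : dirichletKernel (k + 1) t = dirichletKernel k t + Real.cos ((k + 1 : ℕ) * t) := by
      unfold dirichletKernel
      rw [Finset.sum_Icc_succ_top (by omega)]
      ring
    rw [h, mul_add, ih]
    have e1 : ((k : ℝ) + 1 / 2) * t = ((k : ℝ) + 1) * t - t / 2 := by ring
    have e2 : (((k + 1 : ℕ) : ℝ) + 1 / 2) * t = ((k : ℝ) + 1) * t + t / 2 := by push_cast; ring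
    rw [e1, e2, Real.sin_sub, Real.sin_add]
    push_cast
    ring

lemma cos_half_odd_mul_pi (k : ℕ) : Real.cos (((k : ℝ) + 1 / 2) * π) = 0 := by
  rw [Real.cos_eq_zero_iff]
  exact ⟨k, by push_cast; ring⟩

lemma sawtoothRemainder_pi (k : ℕ) : sawtoothRemainder k π = 0 := by
  simp [sawtoothRemainder, Real.sin_nat_mul_pi]

lemma sawtoothRemainder_zero (k : ℕ) : sawtoothRemainder k 0 = π / 2 := by
  simp [sawtoothRemainder]

lemma sin_nat_mul_period_sub (j : ℕ) (t : ℝ) :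
    Real.sin (j * (2 * π - t)) = -Real.sin (j * t) := by
  rw [mul_sub, Real.sin_nat_mul_two_pi_sub]

lemma sawtoothRemainder_two_pi_sub (k : ℕ) (t : ℝ) :
    sawtoothRemainder k (2 * π - t) = -sawtoothRemainder k t := by
  unfold sawtoothRemainder
  simp_rw [sin_nat_mul_period_sub, neg_div, Finset.sum_neg_distrib]
  ring

lemma weightedRemainder_two_pi_sub (l : ℕ) (t : ℝ) :
    weightedRemainder l (2 * π - t) = -weightedRemainder l t := by
  unfold weightedRemainder
  simp_rw [sawtoothRemainder_two_pi_sub, mul_neg, Finset.sum_neg_distrib]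

lemma hasDerivAt_cos_div_sin_sq {t : ℝ} (hs : Real.sin (t / 2) ≠ 0) :
    HasDerivAt (fun t => Real.cos (t / 2) / Real.sin (t / 2) ^ 2)
      (-(1 + Real.cos (t / 2) ^ 2) / (2 * Real.sin (t / 2) ^ 3)) t := by
  have h0 : HasDerivAt (fun t : ℝ => t / 2) (1 / 2) t := (hasDerivAt_id t).div_const 2
  refine (h0.cos.div (h0.sin.pow 2) (pow_ne_zero 2 hs)).congr_deriv ?_
  have h := Real.sin_sq_add_cos_sq (t / 2)
  simp only [Pi.pow_apply, Nat.cast_ofNat]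
  field_simp
  linear_combination (-Real.sin (t / 2)) * h

/-- The second-order asymptotic expansion of the sawtooth remainder. -/
lemma abs_sawtoothRemainder_sub_le (k : ℕ) {t : ℝ} (ht : 0 < t) (htpi : t ≤ π) :
    |sawtoothRemainder k t - Real.cos ((k + 1 / 2) * t) / (2 * (k + 1 / 2) * Real.sin (t / 2))| ≤
      1 / (2 * ((k : ℝ) + 1 / 2) ^ 2 * Real.sin (t / 2) ^ 2) := by
  set μ : ℝ := (k : ℝ) + 1 / 2 with hμ
  have hμ0 : 0 < μ := by positivity
  have hsin : ∀ x ∈ Set.Icc t π, 0 < Real.sin (x / 2) := fun x hx =>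
    Real.sin_pos_of_pos_of_lt_pi (by linarith [hx.1]) (by linarith [hx.2, Real.pi_pos])
  let G : ℝ → ℝ := fun x => Real.cos (x / 2) / Real.sin (x / 2) ^ 2 / (4 * μ ^ 2)
  let H : ℝ → ℝ := fun x => sawtoothRemainder k x - Real.cos (μ * x) / (2 * μ * Real.sin (x / 2))
    - Real.sin (μ * x) * (Real.cos (x / 2) / Real.sin (x / 2) ^ 2) / (4 * μ ^ 2)
  have hG : ∀ x ∈ Set.Icc t π, HasDerivAt G
      (-(1 + Real.cos (x / 2) ^ 2) / (2 * Real.sin (x / 2) ^ 3) / (4 * μ ^ 2)) x := fun x hx =>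
    (hasDerivAt_cos_div_sin_sq (hsin x hx).ne').div_const _
  have hH : ∀ x ∈ Set.Icc t π, HasDerivAt H
      (Real.sin (μ * x) * ((1 + Real.cos (x / 2) ^ 2) / (2 * Real.sin (x / 2) ^ 3) / (4 * μ ^ 2)))
      x := by
    intro x hx
    have hs := (hsin x hx).ne'
    have h0 : HasDerivAt (fun t : ℝ => t / 2) (1 / 2) x := (hasDerivAt_id x).div_const 2
    have hm : HasDerivAt (fun t : ℝ => μ * t) (μ * 1) x := (hasDerivAt_id x).const_mul μ
    have h1 := hasDerivAt_sawtoothRemainder k x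
    have h2 := hm.cos.div (h0.sin.const_mul (2 * μ)) (by positivity)
    have h3 := (hm.sin.mul (hasDerivAt_cos_div_sin_sq hs)).div_const (4 * μ ^ 2)
    refine ((h1.sub h2).sub h3).congr_deriv ?_
    have hD : dirichletKernel k x = Real.sin (μ * x) / (2 * Real.sin (x / 2)) := by
      rw [eq_div_iff (by positivity), hμ, ← two_sin_mul_dirichletKernel]
      ring
    rw [hD]
    field_simp
    ring
  have hGpi : G π = 0 := by simp [G]
  have hHpi : H π = 0 := by
    simp only [H, sawtoothRemainder_pi, hμ, cos_half_odd_mul_pi, Real.cos_pi_div_two]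
    simp
  have key : ∀ ε : ℝ, |ε| ≤ 1 → ε * H t ≤ G t := by
    intro ε hε
    have hd : ∀ x ∈ Set.Icc t π, HasDerivAt (fun x => G x - ε * H x) _ x := fun x hx =>
      (hG x hx).sub ((hH x hx).const_mul ε)
    have hanti : AntitoneOn (fun x => G x - ε * H x) (Set.Icc t π) := by
      refine antitoneOn_of_deriv_nonpos (convex_Icc t π)
        (fun x hx => (hd x hx).continuousAt.continuousWithinAt)
        (fun x hx => (hd x (interior_subset hx)).differentiableAt.differentiableWithinAt) ?_
      intro x hx
      have hx := interior_subset hx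
      rw [(hd x hx).deriv]
      have hs := hsin x hx
      set q := (1 + Real.cos (x / 2) ^ 2) / (2 * Real.sin (x / 2) ^ 3) / (4 * μ ^ 2) with hq
      have hq0 : 0 ≤ q := by positivity
      have e : -(1 + Real.cos (x / 2) ^ 2) / (2 * Real.sin (x / 2) ^ 3) / (4 * μ ^ 2) = -q := by
        rw [hq]; ring
      rw [e]
      have hεs : |ε * Real.sin (μ * x)| ≤ 1 := by
        rw [abs_mul]
        exact mul_le_one₀ hε (abs_nonneg _) (Real.abs_sin_le_one _)
      have := (abs_le.1 hεs).1
      nlinarith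
    have := hanti (Set.left_mem_Icc.2 htpi) (Set.right_mem_Icc.2 htpi) htpi
    simp only [hGpi, hHpi, mul_zero, sub_zero] at this
    linarith
  have h1 := key 1 (by simp)
  have h2 := key (-1) (by simp)
  have hs := hsin t ⟨le_rfl, htpi⟩
  have hc0 : 0 ≤ Real.cos (t / 2) :=
    Real.cos_nonneg_of_neg_pi_div_two_le_of_le (by linarith [Real.pi_pos]) (by linarith)
  have hc1 := Real.cos_le_one (t / 2)
  have hGt : G t ≤ 1 / (4 * μ ^ 2 * Real.sin (t / 2) ^ 2) := by
    simp only [G]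
    rw [div_div, mul_comm (Real.sin (t / 2) ^ 2)]
    gcongr
  have h3 : |Real.sin (μ * t) * (Real.cos (t / 2) / Real.sin (t / 2) ^ 2) / (4 * μ ^ 2)| ≤ G t := by
    have e : Real.sin (μ * t) * (Real.cos (t / 2) / Real.sin (t / 2) ^ 2) / (4 * μ ^ 2) =
        Real.sin (μ * t) * G t := by simp only [G]; ring
    have hG0 : 0 ≤ G t := by simp only [G]; positivity
    rw [e, abs_mul, abs_of_nonneg hG0]
    exact mul_le_of_le_one_left hG0 (Real.abs_sin_le_one _)
  have e2 : 1 / (2 * μ ^ 2 * Real.sin (t / 2) ^ 2) =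
      2 * (1 / (4 * μ ^ 2 * Real.sin (t / 2) ^ 2)) := by field_simp; norm_num
  rw [e2]
  have e3 : sawtoothRemainder k t - Real.cos (μ * t) / (2 * μ * Real.sin (t / 2)) =
    H t + Real.sin (μ * t) * (Real.cos (t / 2) / Real.sin (t / 2) ^ 2) / (4 * μ ^ 2) := by
    simp only [H]; ring
  rw [e3]
  have h4 : |H t| ≤ G t := abs_le.2 ⟨by linarith, by linarith⟩
  exact (abs_add_le _ _).trans (by linarith)

lemma sum_mul_sin (l : ℕ) (t : ℝ) :
    4 * Real.sin (t / 2) ^ 2 * ∑ k ∈ Finset.Icc 1 l, (k : ℝ) * Real.sin (k * t) =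
      Real.sin ((l + 1) * t) - 2 * (l + 1) * Real.sin (t / 2) * Real.cos ((l + 1 / 2) * t) := by
  induction l with
  | zero =>
    have h : Real.sin t = 2 * Real.sin (t / 2) * Real.cos (t / 2) := by
      rw [← Real.sin_two_mul]; ring_nf
    simp only [Nat.cast_zero]
    norm_num
    rw [h, show 1 / 2 * t = t / 2 by ring]
    ring
  | succ l ih =>
    rw [Finset.sum_Icc_succ_top (by omega), mul_add, ih]
    push_cast
    have e1 : ((l : ℝ) + 1 / 2) * t = ((l : ℝ) + 1) * t - t / 2 := by ring
    have e2 : ((l : ℝ) + 1 + 1 / 2) * t = ((l : ℝ) + 1) * t + t / 2 := by ring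
    have e3 : ((l : ℝ) + 1 + 1) * t = ((l : ℝ) + 1) * t + 2 * (t / 2) := by ring
    rw [e1, e2, e3, Real.cos_sub, Real.cos_add, Real.sin_add, Real.sin_two_mul, Real.cos_two_mul]
    have h := Real.sin_sq_add_cos_sq (t / 2)
    linear_combination (-2 * Real.sin ((l + 1) * t)) * h

lemma weightedRemainder_eq (l : ℕ) (t : ℝ) :
    weightedRemainder l t =
      ((l : ℝ) + 1) ^ 2 * sawtoothRemainder l t +
        ∑ k ∈ Finset.Icc 1 l, (k : ℝ) * Real.sin (k * t) := by
  induction l with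
  | zero => simp [weightedRemainder]
  | succ l ih =>
    have h : sawtoothRemainder (l + 1) t =
        sawtoothRemainder l t - Real.sin (((l : ℝ) + 1) * t) / ((l : ℝ) + 1) := by
      unfold sawtoothRemainder
      rw [Finset.sum_Icc_succ_top (by omega)]
      push_cast
      ring
    have h0 : (l : ℝ) + 1 ≠ 0 := by positivity
    unfold weightedRemainder at ih ⊢
    rw [Finset.sum_range_succ, ih, h, Finset.sum_Icc_succ_top (by omega)]
    generalize ∑ k ∈ Finset.Icc 1 l, (k : ℝ) * Real.sin (k * t) = σ
    push_cast
    field_simp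
    ring

lemma abs_weightedRemainder_le_inv_sq (l : ℕ) {t : ℝ} (ht : 0 < t) (htpi : t ≤ π) :
    |weightedRemainder l t| ≤ 3 * π ^ 2 / t ^ 2 := by
  have hs : t / π ≤ Real.sin (t / 2) := by
    have := Real.mul_le_sin (x := t / 2) (by linarith) (by linarith)
    calc t / π = 2 / π * (t / 2) := by ring
      _ ≤ _ := this
  have hs0 : 0 < Real.sin (t / 2) := lt_of_lt_of_le (by positivity) hs
  set s := Real.sin (t / 2) with hsdef
  have hs1 : s ≤ 1 := Real.sin_le_one _
  set L : ℝ := (l : ℝ) + 1 with hL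
  set μ : ℝ := (l : ℝ) + 1 / 2 with hμ
  have hμ0 : 0 < μ := by positivity
  have hLμ : L ≤ 2 * μ := by simp only [hL, hμ]; linarith [(Nat.cast_nonneg l : (0 : ℝ) ≤ l)]
  have hL0 : 0 < L := by positivity
  have herr := abs_sawtoothRemainder_sub_le l ht htpi
  have hsum := sum_mul_sin l t
  rw [← hsdef, ← hμ] at herr hsum
  rw [← hL] at hsum
  set e := sawtoothRemainder l t - Real.cos (μ * t) / (2 * μ * s) with he
  have hr : sawtoothRemainder l t = e + Real.cos (μ * t) / (2 * μ * s) := by rw [he]; ring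
  have hσ : ∑ k ∈ Finset.Icc 1 l, (k : ℝ) * Real.sin (k * t) =
      (Real.sin (L * t) - 2 * L * s * Real.cos (μ * t)) / (4 * s ^ 2) := by
    rw [eq_div_iff (by positivity), ← hsum]; ring
  have hdecomp : weightedRemainder l t =
      L ^ 2 * e + Real.sin (L * t) / (4 * s ^ 2) + L / (4 * s * μ) * Real.cos (μ * t) := by
    rw [weightedRemainder_eq, ← hL, hr, hσ]
    have : L = μ + 1 / 2 := by rw [hL, hμ]; ring
    rw [this]
    field_simp
    ring
  have b1 : |L ^ 2 * e| ≤ 2 / s ^ 2 := by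
    rw [abs_mul, abs_of_pos (by positivity : 0 < L ^ 2)]
    calc L ^ 2 * |e| ≤ (2 * μ) ^ 2 * (1 / (2 * μ ^ 2 * s ^ 2)) := by gcongr
      _ = 2 / s ^ 2 := by field_simp
  have b2 : |Real.sin (L * t) / (4 * s ^ 2)| ≤ 1 / 4 / s ^ 2 := by
    rw [abs_div, abs_of_pos (by positivity : 0 < 4 * s ^ 2), div_div]
    gcongr
    exact Real.abs_sin_le_one _
  have b3 : |L / (4 * s * μ) * Real.cos (μ * t)| ≤ 1 / 2 / s ^ 2 := by
    rw [abs_mul, abs_of_pos (by positivity : 0 < L / (4 * s * μ))]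
    calc L / (4 * s * μ) * |Real.cos (μ * t)| ≤ 2 * μ / (4 * s * μ) * 1 := by
          gcongr
          exact Real.abs_cos_le_one _
      _ = 1 / 2 / s := by field_simp; norm_num
      _ ≤ 1 / 2 / s ^ 2 := by
          gcongr
          nlinarith
  have b4 : 3 / s ^ 2 ≤ 3 * π ^ 2 / t ^ 2 := by
    calc 3 / s ^ 2 ≤ 3 / (t / π) ^ 2 := by gcongr
      _ = 3 * π ^ 2 / t ^ 2 := by field_simp
  rw [hdecomp]
  refine (abs_add_three _ _ _).trans (le_trans ?_ b4)
  have : 3 / s ^ 2 = 2 / s ^ 2 + 1 / 4 / s ^ 2 + 1 / 2 / s ^ 2 + 1 / 4 / s ^ 2 := by ring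
  have h4 : 0 ≤ 1 / 4 / s ^ 2 := by positivity
  linarith

lemma abs_weightedRemainder_le_sq (l : ℕ) {t : ℝ} (ht : 0 < t) (hlt : ((l : ℝ) + 1) * t ≤ 1) :
    |weightedRemainder l t| ≤ 4 * ((l : ℝ) + 1) ^ 2 := by
  have hl : (0 : ℝ) ≤ l := Nat.cast_nonneg l
  have ht1 : t ≤ 1 := by nlinarith
  have hP : |∑ j ∈ Finset.Icc 1 l, Real.sin (j * t) / j| ≤ 1 := by
    refine (Finset.abs_sum_le_sum_abs _ _).trans ?_
    have : ∀ j ∈ Finset.Icc 1 l, |Real.sin (j * t) / j| ≤ t := by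
      intro j hj
      have hj0 : (0 : ℝ) < j := by exact_mod_cast (Finset.mem_Icc.1 hj).1
      rw [abs_div, abs_of_pos hj0, div_le_iff₀ hj0]
      refine (Real.abs_sin_le_abs).trans ?_
      rw [abs_of_pos (by positivity), mul_comm]
    refine (Finset.sum_le_card_nsmul _ _ _ this).trans ?_
    simp only [Nat.card_Icc, Nat.add_sub_cancel, nsmul_eq_mul]
    nlinarith
  have hr : |sawtoothRemainder l t| ≤ 3 := by
    unfold sawtoothRemainder
    refine (abs_sub _ _).trans ?_
    have : |(π - t) / 2| ≤ 2 := by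
      rw [abs_of_nonneg (by linarith [Real.pi_gt_three])]
      linarith [Real.pi_le_four]
    linarith
  have hσ : |∑ k ∈ Finset.Icc 1 l, (k : ℝ) * Real.sin (k * t)| ≤ ((l : ℝ) + 1) ^ 2 := by
    refine (Finset.abs_sum_le_sum_abs _ _).trans ?_
    have : ∀ j ∈ Finset.Icc 1 l, |(j : ℝ) * Real.sin (j * t)| ≤ l := by
      intro j hj
      have hjl : (j : ℝ) ≤ l := by exact_mod_cast (Finset.mem_Icc.1 hj).2
      rw [abs_mul, Nat.abs_cast]
      exact (mul_le_of_le_one_right (Nat.cast_nonneg j) (Real.abs_sin_le_one _)).trans hjl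
    refine (Finset.sum_le_card_nsmul _ _ _ this).trans ?_
    simp only [Nat.card_Icc, Nat.add_sub_cancel, nsmul_eq_mul]
    nlinarith
  rw [weightedRemainder_eq]
  refine (abs_add_le _ _).trans ?_
  rw [abs_mul, abs_of_pos (by positivity : (0 : ℝ) < ((l : ℝ) + 1) ^ 2)]
  nlinarith [sq_nonneg ((l : ℝ) + 1)]

lemma abs_weightedRemainder_le (l : ℕ) {t : ℝ} (ht : 0 < t) (htpi : t ≤ π) :
    |weightedRemainder l t| ≤
      6 * π ^ 2 * ((l : ℝ) + 1) ^ 2 * (1 + (((l : ℝ) + 1) * t) ^ 2)⁻¹ := by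
  set L : ℝ := (l : ℝ) + 1 with hL
  have hL0 : 0 < L := by positivity
  have hpi := Real.pi_gt_three
  rw [← div_eq_mul_inv, le_div_iff₀ (by positivity)]
  rcases le_total (L * t) 1 with h | h
  · have h1 := abs_weightedRemainder_le_sq l ht h
    have h2 : (L * t) ^ 2 ≤ 1 := pow_le_one₀ (by positivity) h
    calc |weightedRemainder l t| * (1 + (L * t) ^ 2) ≤ (4 * L ^ 2) * (1 + 1) := by gcongr
      _ = 8 * L ^ 2 := by ring
      _ ≤ 6 * π ^ 2 * L ^ 2 := by gcongr; nlinarith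
  · have h1 := abs_weightedRemainder_le_inv_sq l ht htpi
    have h2 : 1 ≤ (L * t) ^ 2 := one_le_pow₀ h
    calc |weightedRemainder l t| * (1 + (L * t) ^ 2)
        ≤ (3 * π ^ 2 / t ^ 2) * ((L * t) ^ 2 + (L * t) ^ 2) := by gcongr
      _ = 6 * π ^ 2 * L ^ 2 := by field_simp; ring

lemma integral_abs_weightedRemainder_le (l : ℕ) :
    ∫ t in (0 : ℝ)..(2 * π), |weightedRemainder l t| ≤ 6 * π ^ 3 * ((l : ℝ) + 1) := by
  have hpi := Real.pi_pos
  have hc : Continuous fun t => |weightedRemainder l t| := (continuous_weightedRemainder l).abs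
  set L : ℝ := (l : ℝ) + 1 with hL
  have hL0 : 0 < L := by positivity
  have hhalf : ∫ t in (0 : ℝ)..π, |weightedRemainder l t| ≤ 3 * π ^ 3 * L := by
    have hc2 : Continuous fun t : ℝ => 6 * π ^ 2 * L ^ 2 * (1 + (L * t) ^ 2)⁻¹ :=
      continuous_const.mul (Continuous.inv₀ (by fun_prop) fun t => by positivity)
    calc ∫ t in (0 : ℝ)..π, |weightedRemainder l t|
        ≤ ∫ t in (0 : ℝ)..π, 6 * π ^ 2 * L ^ 2 * (1 + (L * t) ^ 2)⁻¹ := by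
          refine intervalIntegral.integral_mono_on_of_le_Ioo hpi.le (hc.intervalIntegrable _ _)
            (hc2.intervalIntegrable _ _) fun t ht => ?_
          exact abs_weightedRemainder_le l ht.1 ht.2.le
      _ = 6 * π ^ 2 * L ^ 2 * (L⁻¹ * Real.arctan (L * π)) := by
          rw [intervalIntegral.integral_const_mul,
            intervalIntegral.integral_comp_mul_left (fun t => (1 + t ^ 2)⁻¹) hL0.ne',
            integral_inv_one_add_sq]
          simp
      _ ≤ 6 * π ^ 2 * L ^ 2 * (L⁻¹ * (π / 2)) := by
          gcongr
          exact (Real.arctan_lt_pi_div_two _).le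
      _ = 3 * π ^ 3 * L := by field_simp; ring
  have hsymm : ∫ t in π..(2 * π), |weightedRemainder l t| =
      ∫ t in (0 : ℝ)..π, |weightedRemainder l t| := by
    have := intervalIntegral.integral_comp_sub_left (a := 0) (b := π)
      (fun t => |weightedRemainder l t|) (2 * π)
    simp only [weightedRemainder_two_pi_sub, abs_neg] at this
    rw [this]
    congr 1 <;> ring
  rw [← intervalIntegral.integral_add_adjacent_intervals (hc.intervalIntegrable 0 π)
    (hc.intervalIntegrable π (2 * π)), hsymm]
  linarith

/-! ### Summation by parts for rows of bounded head variation -/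

lemma sum_mul_eq_sum_sub_mul_sum (b g : ℕ → ℝ) (n : ℕ) :
    ∑ k ∈ Finset.range (n + 1), b k * g k =
      b n * ∑ i ∈ Finset.range (n + 1), g i +
        ∑ k ∈ Finset.range n, (b k - b (k + 1)) * ∑ i ∈ Finset.range (k + 1), g i := by
  induction n with
  | zero => simp
  | succ n ih =>
    rw [Finset.sum_range_succ, ih, Finset.sum_range_succ (fun k => (b k - b (k + 1)) * _) n,
      Finset.sum_range_succ g (n + 1)]
    ring

lemma rpow_div_le_sub {β : ℝ} (hβ : 0 < β) (k : ℕ) :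
    ((k : ℝ) + 1) ^ β / ((k : ℝ) + 1) ≤
      2 / β * (((k : ℝ) + 2) ^ β - ((k : ℝ) + 1) ^ β) := by
  set x : ℝ := (k : ℝ) + 1 with hx
  have hx1 : 1 ≤ x := by rw [hx]; linarith [(Nat.cast_nonneg k : (0 : ℝ) ≤ k)]
  have hx0 : 0 < x := by linarith
  have e : (k : ℝ) + 2 = x * (1 + 1 / x) := by rw [mul_add, mul_one_div_cancel hx0.ne', hx]; ring
  rw [e, Real.mul_rpow hx0.le (by positivity)]
  have hlog : 1 / (2 * x) ≤ Real.log (1 + 1 / x) := by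
    refine le_trans ?_ (Real.one_sub_inv_le_log_of_pos (by positivity))
    have e2 : 1 - (1 + 1 / x)⁻¹ = 1 / (x + 1) := by field_simp; ring
    rw [e2]
    gcongr
    linarith
  have hexp : 1 + β / (2 * x) ≤ (1 + 1 / x) ^ β := by
    rw [Real.rpow_def_of_pos (by positivity)]
    refine le_trans ?_ (Real.add_one_le_exp _)
    have := mul_le_mul_of_nonneg_right hlog hβ.le
    have e3 : 1 / (2 * x) * β = β / (2 * x) := by ring
    linarith
  have hp : 0 < x ^ β := Real.rpow_pos_of_pos hx0 β
  calc x ^ β / x = 2 / β * (x ^ β * (1 + β / (2 * x)) - x ^ β) := by field_simp; ring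
    _ ≤ 2 / β * (x ^ β * (1 + 1 / x) ^ β - x ^ β) := by gcongr

lemma mul_abs_sub_rpow_div_le {β : ℝ} (hβ : 0 < β) (k : ℕ) :
    ((k : ℝ) + 1) *
        |((k : ℝ) + 1) ^ β / (2 * k + 1) - ((k : ℝ) + 2) ^ β / (2 * k + 3)| ≤
      (1 + 2 / β) * (((k : ℝ) + 2) ^ β - ((k : ℝ) + 1) ^ β) := by
  have hk : (0 : ℝ) ≤ k := Nat.cast_nonneg k
  have h1 := rpow_div_le_sub hβ k
  have hp : 0 < ((k : ℝ) + 1) ^ β := Real.rpow_pos_of_pos (by positivity) β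
  have hmono : ((k : ℝ) + 1) ^ β ≤ ((k : ℝ) + 2) ^ β :=
    Real.rpow_le_rpow (by positivity) (by linarith) hβ.le
  set p := ((k : ℝ) + 1) ^ β
  set q := ((k : ℝ) + 2) ^ β
  have e : p / (2 * k + 1) - q / (2 * k + 3) =
      2 * p / ((2 * k + 1) * (2 * k + 3)) - (q - p) / (2 * k + 3) := by
    field_simp
    ring
  have hqp : 0 ≤ q - p := by linarith
  rw [e]
  have h2 : ((k : ℝ) + 1) * (2 * p / ((2 * k + 1) * (2 * k + 3))) ≤ p / ((k : ℝ) + 1) := by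
    rw [← mul_div_assoc, div_le_div_iff₀ (by positivity) (by positivity)]
    nlinarith [mul_nonneg hp.le hk, mul_nonneg (mul_nonneg hp.le hk) hk]
  have h3 : ((k : ℝ) + 1) * ((q - p) / (2 * k + 3)) ≤ q - p := by
    rw [← mul_div_assoc, div_le_iff₀ (by positivity)]
    nlinarith [mul_nonneg hqp hk]
  have h4 : |2 * p / ((2 * k + 1) * (2 * k + 3)) - (q - p) / (2 * (k : ℝ) + 3)| ≤
      2 * p / ((2 * k + 1) * (2 * k + 3)) + (q - p) / (2 * (k : ℝ) + 3) := by
    refine (abs_sub _ _).trans ?_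
    rw [abs_of_nonneg (by positivity), abs_of_nonneg (by positivity)]
  calc _ ≤ ((k : ℝ) + 1) * (2 * p / ((2 * k + 1) * (2 * k + 3)) + (q - p) / (2 * (k : ℝ) + 3)) := by
        gcongr
    _ ≤ _ := by nlinarith

/-- A row `(k+1)^β c_k` with `c` of bounded head variation: the weighted variation of the row divided
by `2k+1` is controlled by its last entry. -/
lemma sum_mul_abs_sub_le {β K : ℝ} (hβ : 0 < β) (c : ℕ → ℝ) (n : ℕ)
    (hc : ∀ k ≤ n, 0 ≤ c k)
    (hK : ∑ k ∈ Finset.range n, |c k - c (k + 1)| ≤ K * c n) :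
    ∑ k ∈ Finset.range n, ((k : ℝ) + 1) *
        |((k : ℝ) + 1) ^ β * c k / (2 * k + 1) - ((k : ℝ) + 2) ^ β * c (k + 1) / (2 * k + 3)| ≤
      (K + (1 + K) * (1 + 2 / β)) * (((n : ℝ) + 1) ^ β * c n) := by
  have hbound : ∀ k ≤ n, c k ≤ (1 + K) * c n := by
    intro k hk
    have h1 : c k - c n = ∑ j ∈ Finset.Ico k n, (c j - c (j + 1)) := by
      have := Finset.sum_Ico_sub c hk
      rw [← neg_inj, ← Finset.sum_neg_distrib]
      simp only [neg_sub]
      exact this.symm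
    have h2 : c k - c n ≤ ∑ j ∈ Finset.range n, |c j - c (j + 1)| := by
      rw [h1]
      refine (Finset.sum_le_sum fun j _ => le_abs_self _).trans ?_
      exact Finset.sum_le_sum_of_subset_of_nonneg
        (fun j hj => Finset.mem_range.2 (Finset.mem_Ico.1 hj).2) fun _ _ _ => abs_nonneg _
    linarith
  have hmono : ∀ k < n, ((k : ℝ) + 1) ^ β ≤ ((n : ℝ) + 1) ^ β := by
    intro k hk
    have : (k : ℝ) ≤ n := by exact_mod_cast hk.le
    exact Real.rpow_le_rpow (by positivity) (by linarith) hβ.le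
  have hterm : ∀ k ∈ Finset.range n, ((k : ℝ) + 1) *
      |((k : ℝ) + 1) ^ β * c k / (2 * k + 1) - ((k : ℝ) + 2) ^ β * c (k + 1) / (2 * k + 3)| ≤
      ((n : ℝ) + 1) ^ β * |c k - c (k + 1)| +
        (1 + K) * c n * ((1 + 2 / β) * (((k : ℝ) + 2) ^ β - ((k : ℝ) + 1) ^ β)) := by
    intro k hk
    have hkn := Finset.mem_range.1 hk
    have hp : 0 < ((k : ℝ) + 1) ^ β := Real.rpow_pos_of_pos (by positivity) β
    have hq := mul_abs_sub_rpow_div_le hβ k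
    set x := ((k : ℝ) + 1) ^ β / (2 * k + 1) - ((k : ℝ) + 2) ^ β / (2 * k + 3) with hx
    have e : ((k : ℝ) + 1) ^ β * c k / (2 * k + 1) - ((k : ℝ) + 2) ^ β * c (k + 1) / (2 * k + 3) =
        ((k : ℝ) + 1) ^ β / (2 * k + 1) * (c k - c (k + 1)) + x * c (k + 1) := by
      rw [hx]; ring
    have hc1 : 0 ≤ c (k + 1) := hc _ hkn
    have h1 : |((k : ℝ) + 1) ^ β * c k / (2 * k + 1) - ((k : ℝ) + 2) ^ β * c (k + 1) / (2 * k + 3)|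
        ≤ ((k : ℝ) + 1) ^ β / (2 * k + 1) * |c k - c (k + 1)| + |x| * c (k + 1) := by
      rw [e]
      refine (abs_add_le _ _).trans ?_
      rw [abs_mul, abs_mul, abs_of_pos (by positivity : 0 < ((k : ℝ) + 1) ^ β / (2 * k + 1)),
        abs_of_nonneg hc1]
    have h2 : ((k : ℝ) + 1) * (((k : ℝ) + 1) ^ β / (2 * k + 1)) ≤ ((n : ℝ) + 1) ^ β := by
      refine le_trans ?_ (hmono k hkn)
      rw [← mul_div_assoc, div_le_iff₀ (by positivity)]
      nlinarith [mul_nonneg hp.le (Nat.cast_nonneg k : (0 : ℝ) ≤ k)]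
    have h0 : 0 ≤ ((k : ℝ) + 1) * |x| := by positivity
    calc ((k : ℝ) + 1) * _ ≤ ((k : ℝ) + 1) *
          (((k : ℝ) + 1) ^ β / (2 * k + 1) * |c k - c (k + 1)| + |x| * c (k + 1)) := by gcongr
      _ = ((k : ℝ) + 1) * (((k : ℝ) + 1) ^ β / (2 * k + 1)) * |c k - c (k + 1)| +
          c (k + 1) * (((k : ℝ) + 1) * |x|) := by ring
      _ ≤ _ := by
          have h3 := hbound (k + 1) hkn
          have h4 : 0 ≤ (1 + K) * c n := hc1.trans h3
          gcongr
  refine (Finset.sum_le_sum hterm).trans ?_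
  rw [Finset.sum_add_distrib, ← Finset.mul_sum, ← Finset.mul_sum, ← Finset.mul_sum]
  have htel : ∑ k ∈ Finset.range n, (((k : ℝ) + 2) ^ β - ((k : ℝ) + 1) ^ β) ≤
      ((n : ℝ) + 1) ^ β := by
    have h := Finset.sum_range_sub (fun k : ℕ => ((k : ℝ) + 1) ^ β) n
    have e : ∀ k : ℕ, ((k + 1 : ℕ) : ℝ) + 1 = (k : ℝ) + 2 := fun k => by push_cast; ring
    simp only [e] at h
    rw [h]
    simp
  have h4 : 0 ≤ (1 + K) * c n := (hc n le_rfl).trans (hbound n le_rfl)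
  have hpn : 0 < ((n : ℝ) + 1) ^ β := Real.rpow_pos_of_pos (by positivity) β
  calc _ ≤ ((n : ℝ) + 1) ^ β * (K * c n) +
        (1 + K) * c n * ((1 + 2 / β) * ((n : ℝ) + 1) ^ β) := by gcongr
    _ = _ := by ring

/-- The `L¹` norm of the kernel that represents `T_n f - f` as a convolution with `f'`. -/
lemma integral_abs_sum_mul_sawtoothRemainder_le {β K : ℝ} (hβ : 0 < β) (a : ℕ → ℝ) (n : ℕ)
    (ha : ∀ k ≤ n, 0 ≤ a k)
    (hK : ∑ k ∈ Finset.range n,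
      |((k : ℝ) + 1) ^ (-β) * a k - ((k : ℝ) + 2) ^ (-β) * a (k + 1)| ≤
        K * (((n : ℝ) + 1) ^ (-β) * a n)) :
    ∫ t in (0 : ℝ)..(2 * π), |∑ k ∈ Finset.range (n + 1), a k * sawtoothRemainder k t| ≤
      6 * π ^ 3 * (1 + (K + (1 + K) * (1 + 2 / β))) * a n := by
  have hpi := Real.pi_pos
  set c : ℕ → ℝ := fun k => ((k : ℝ) + 1) ^ (-β) * a k with hcdef
  set b : ℕ → ℝ := fun k => a k / (2 * (k : ℝ) + 1) with hbdef
  have hac : ∀ k : ℕ, a k = ((k : ℝ) + 1) ^ β * c k := by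
    intro k
    rw [hcdef, ← mul_assoc, ← Real.rpow_add (by positivity)]
    simp
  have hcast : ∀ k : ℕ, ((k + 1 : ℕ) : ℝ) + 1 = (k : ℝ) + 2 := fun k => by push_cast; ring
  have hvar := sum_mul_abs_sub_le (K := K) hβ c n
    (fun k hk => mul_nonneg (Real.rpow_nonneg (by positivity) _) (ha k hk))
    (by simpa only [hcdef, hcast] using hK)
  have hvar' : ∑ k ∈ Finset.range n, ((k : ℝ) + 1) * |b k - b (k + 1)| ≤
      (K + (1 + K) * (1 + 2 / β)) * a n := by
    rw [hac n]
    refine le_trans (le_of_eq (Finset.sum_congr rfl fun k _ => ?_)) hvar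
    have e : 2 * ((k + 1 : ℕ) : ℝ) + 1 = 2 * (k : ℝ) + 3 := by push_cast; ring
    simp only [hbdef]
    rw [e, hac k, hac (k + 1), hcast]
  have hbn : b n * ((n : ℝ) + 1) ≤ a n := by
    simp only [hbdef]
    rw [div_mul_eq_mul_div, div_le_iff₀ (by positivity)]
    nlinarith [mul_nonneg (ha n le_rfl) (Nat.cast_nonneg n : (0 : ℝ) ≤ n)]
  have hbn0 : 0 ≤ b n := div_nonneg (ha n le_rfl) (by positivity)
  have hrep : ∀ t, ∑ k ∈ Finset.range (n + 1), a k * sawtoothRemainder k t =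
      b n * weightedRemainder n t +
        ∑ k ∈ Finset.range n, (b k - b (k + 1)) * weightedRemainder k t := by
    intro t
    unfold weightedRemainder
    rw [← sum_mul_eq_sum_sub_mul_sum b]
    refine Finset.sum_congr rfl fun k _ => ?_
    simp only [hbdef]
    field_simp
  have hcont : ∀ k, Continuous fun t => |weightedRemainder k t| := fun k =>
    (continuous_weightedRemainder k).abs
  have hcL : Continuous fun t => |∑ k ∈ Finset.range (n + 1), a k * sawtoothRemainder k t| :=
    (continuous_finsetSum _ fun k _ =>
      continuous_const.mul (continuous_sawtoothRemainder k)).abs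
  have hcS : ∀ k, Continuous fun t => |b k - b (k + 1)| * |weightedRemainder k t| := fun k =>
    continuous_const.mul (hcont k)
  have hcR : Continuous fun t => b n * |weightedRemainder n t| +
      ∑ k ∈ Finset.range n, |b k - b (k + 1)| * |weightedRemainder k t| :=
    (continuous_const.mul (hcont n)).add (continuous_finsetSum _ fun k _ => hcS k)
  calc _ ≤ ∫ t in (0 : ℝ)..(2 * π), (b n * |weightedRemainder n t| +
        ∑ k ∈ Finset.range n, |b k - b (k + 1)| * |weightedRemainder k t|) := by
        refine intervalIntegral.integral_mono (by positivity) (hcL.intervalIntegrable _ _)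
          (hcR.intervalIntegrable _ _) fun t => ?_
        simp only [hrep]
        refine (abs_add_le _ _).trans (add_le_add ?_ ?_)
        · rw [abs_mul, abs_of_nonneg hbn0]
        · refine (Finset.abs_sum_le_sum_abs _ _).trans (le_of_eq ?_)
          simp only [abs_mul]
    _ = b n * (∫ t in (0 : ℝ)..(2 * π), |weightedRemainder n t|) +
        ∑ k ∈ Finset.range n,
          |b k - b (k + 1)| * ∫ t in (0 : ℝ)..(2 * π), |weightedRemainder k t| := by
        rw [intervalIntegral.integral_add (f := fun t => b n * |weightedRemainder n t|)
            ((continuous_const.mul (hcont n)).intervalIntegrable _ _)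
            ((continuous_finsetSum _ fun k _ => hcS k).intervalIntegrable _ _),
          intervalIntegral.integral_const_mul,
          intervalIntegral.integral_finsetSum fun k _ => (hcS k).intervalIntegrable _ _]
        simp only [intervalIntegral.integral_const_mul]
    _ ≤ b n * (6 * π ^ 3 * ((n : ℝ) + 1)) +
        ∑ k ∈ Finset.range n, |b k - b (k + 1)| * (6 * π ^ 3 * ((k : ℝ) + 1)) := by
        gcongr <;> exact integral_abs_weightedRemainder_le _
    _ = 6 * π ^ 3 * (b n * ((n : ℝ) + 1) +
        ∑ k ∈ Finset.range n, ((k : ℝ) + 1) * |b k - b (k + 1)|) := by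
        rw [mul_add (6 * π ^ 3) (b n * _), Finset.mul_sum]
        congr 1
        · ring
        · exact Finset.sum_congr rfl fun k _ => by ring
    _ ≤ 6 * π ^ 3 * (a n + (K + (1 + K) * (1 + 2 / β)) * a n) := by gcongr
    _ = _ := by ring

/-! ### Convolution with the derivative -/

lemma partialFourierSum_sub_eq {u u' : ℝ → ℝ} (hper : Function.Periodic u (2 * π))
    (hu : ∀ x, HasDerivAt u (u' x) x) (hu' : Continuous u') (k : ℕ) (x : ℝ) :
    partialFourierSum u k x - u x =
      -(1 / π) * ∫ s in (0 : ℝ)..(2 * π), u' (x - s) * sawtoothRemainder k s := by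
  have hpi := Real.pi_pos
  have hDper : Function.Periodic (dirichletKernel k) (2 * π) := by
    intro t
    unfold dirichletKernel
    congr 1
    refine Finset.sum_congr rfl fun j _ => ?_
    rw [mul_add]
    exact Real.cos_add_nat_mul_two_pi _ _
  have hshift : ∫ t in (0 : ℝ)..(2 * π), u t * dirichletKernel k (x - t) =
      ∫ s in (0 : ℝ)..(2 * π), u (x - s) * dirichletKernel k s := by
    have hp : Function.Periodic (fun t => u t * dirichletKernel k (x - t)) (2 * π) := by
      intro t
      have h2 : dirichletKernel k (x - (t + 2 * π)) = dirichletKernel k (x - t) := by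
        rw [← hDper (x - (t + 2 * π))]
        congr 1
        ring
      simp only [hper t, h2]
    have h1 := intervalIntegral.integral_comp_sub_left (a := 0) (b := 2 * π)
      (fun t => u t * dirichletKernel k (x - t)) x
    simp only [sub_sub_cancel, sub_zero] at h1
    rw [h1]
    have h2 := hp.intervalIntegral_add_eq 0 (x - 2 * π)
    rw [zero_add, sub_add_cancel] at h2
    exact h2
  have hcomp : ∀ s, HasDerivAt (fun s => u (x - s)) (-u' (x - s)) s := by
    intro s
    exact ((hu (x - s)).comp s ((hasDerivAt_id s).const_sub x)).congr_deriv (by simp)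
  have hparts := intervalIntegral.integral_mul_deriv_eq_deriv_mul (a := 0) (b := 2 * π)
    (u := fun s => u (x - s)) (v := sawtoothRemainder k) (u' := fun s => -u' (x - s))
    (v' := fun s => -dirichletKernel k s)
    (fun s _ => hcomp s) (fun s _ => hasDerivAt_sawtoothRemainder k s)
    ((hu'.comp (continuous_const.sub continuous_id)).neg.intervalIntegrable _ _)
    ((continuous_dirichletKernel k).neg.intervalIntegrable _ _)
  have hend : sawtoothRemainder k (2 * π) = -(π / 2) := by
    have := sawtoothRemainder_two_pi_sub k 0
    rwa [sub_zero, sawtoothRemainder_zero] at this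
  have hux : u (x - 2 * π) = u x := hper.sub_eq x
  simp only [mul_neg, neg_mul, intervalIntegral.integral_neg, hend, sawtoothRemainder_zero, hux,
    sub_zero] at hparts
  unfold partialFourierSum
  rw [hshift]
  have : ∫ s in (0 : ℝ)..(2 * π), u (x - s) * dirichletKernel k s =
      π * u x - ∫ s in (0 : ℝ)..(2 * π), u' (x - s) * sawtoothRemainder k s := by linarith
  rw [this]
  field_simp
  ring

lemma integral_abs_comp_sub_left {g : ℝ → ℝ} (hg : Function.Periodic g (2 * π)) (s : ℝ) :
    ∫ x in (0 : ℝ)..(2 * π), |g (x - s)| = ∫ x in (0 : ℝ)..(2 * π), |g x| := by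
  rw [intervalIntegral.integral_comp_sub_right (fun x => |g x|)]
  have hp : Function.Periodic (fun x => |g x|) (2 * π) := fun x => by simp only [hg x]
  have := hp.intervalIntegral_add_eq (0 - s) 0
  rw [zero_add] at this
  rw [← this]
  congr 1
  ring

/-- Young's inequality for the convolution of continuous functions over a period. -/
lemma integral_abs_convolution_le {g R : ℝ → ℝ} (hper : Function.Periodic g (2 * π))
    (hg : Continuous g) (hR : Continuous R) :
    ∫ x in (0 : ℝ)..(2 * π), |∫ s in (0 : ℝ)..(2 * π), g (x - s) * R s| ≤
      (∫ x in (0 : ℝ)..(2 * π), |g x|) * ∫ s in (0 : ℝ)..(2 * π), |R s| := by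
  have hpi := Real.pi_pos
  have h2 : (0 : ℝ) ≤ 2 * π := by positivity
  have hF : Continuous (Function.uncurry fun x s : ℝ => |g (x - s)| * |R s|) := by
    unfold Function.uncurry
    fun_prop
  have hF' : Continuous (Function.uncurry fun x s : ℝ => g (x - s) * R s) := by
    unfold Function.uncurry
    fun_prop
  calc _ ≤ ∫ x in (0 : ℝ)..(2 * π), ∫ s in (0 : ℝ)..(2 * π), |g (x - s)| * |R s| := by
        refine intervalIntegral.integral_mono h2
          (intervalIntegral.continuous_parametric_intervalIntegral_of_continuous' hF' _ _
            |>.abs.intervalIntegrable _ _)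
          (intervalIntegral.continuous_parametric_intervalIntegral_of_continuous' hF _ _
            |>.intervalIntegrable _ _) fun x => ?_
        refine (intervalIntegral.abs_integral_le_integral_abs h2).trans (le_of_eq ?_)
        simp only [abs_mul]
    _ = ∫ s in (0 : ℝ)..(2 * π), ∫ x in (0 : ℝ)..(2 * π), |g (x - s)| * |R s| := by
        refine intervalIntegral_intervalIntegral_swap ?_
        refine (hF.continuousOn.integrableOn_compact
          (isCompact_uIcc.prod isCompact_uIcc)).mono_set
          (Set.prod_mono Set.uIoc_subset_uIcc Set.uIoc_subset_uIcc)
    _ = _ := by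
        simp only [intervalIntegral.integral_mul_const, integral_abs_comp_sub_left hper,
          intervalIntegral.integral_const_mul]

lemma integral_abs_matrixMeans_sub_le_of_hasDerivAt {u u' : ℝ → ℝ}
    (hper : Function.Periodic u (2 * π)) (hper' : Function.Periodic u' (2 * π))
    (hu : ∀ x, HasDerivAt u (u' x) x) (hu' : Continuous u') (a : ℕ → ℕ → ℝ) (n : ℕ)
    (hsum : ∑ k ∈ Finset.range (n + 1), a n k = 1) :
    ∫ x in (0 : ℝ)..(2 * π), |matrixMeans a u n x - u x| ≤
      1 / π * ((∫ x in (0 : ℝ)..(2 * π), |u' x|) * ∫ s in (0 : ℝ)..(2 * π),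
        |∑ k ∈ Finset.range (n + 1), a n k * sawtoothRemainder k s|) := by
  have hpi := Real.pi_pos
  have hR : Continuous fun s => ∑ k ∈ Finset.range (n + 1), a n k * sawtoothRemainder k s :=
    continuous_finsetSum _ fun k _ => continuous_const.mul (continuous_sawtoothRemainder k)
  have hrep : ∀ x, matrixMeans a u n x - u x =
      -(1 / π) * ∫ s in (0 : ℝ)..(2 * π),
        u' (x - s) * ∑ k ∈ Finset.range (n + 1), a n k * sawtoothRemainder k s := by
    intro x
    have h1 : matrixMeans a u n x - u x =
        ∑ k ∈ Finset.range (n + 1), a n k * (partialFourierSum u k x - u x) := by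
      simp only [mul_sub, Finset.sum_sub_distrib, ← Finset.sum_mul, hsum, one_mul]
      rfl
    have hc : ∀ k, Continuous fun s => a n k * (u' (x - s) * sawtoothRemainder k s) := fun k =>
      continuous_const.mul ((hu'.comp (continuous_const.sub continuous_id)).mul
        (continuous_sawtoothRemainder k))
    rw [h1]
    simp only [partialFourierSum_sub_eq hper hu hu', Finset.mul_sum]
    simp only [mul_left_comm (u' _)]
    rw [intervalIntegral.integral_finsetSum fun k _ => (hc k).intervalIntegrable _ _,
      Finset.mul_sum]
    refine Finset.sum_congr rfl fun k _ => ?_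
    rw [intervalIntegral.integral_const_mul]
    ring
  simp only [hrep, abs_mul, abs_neg, intervalIntegral.integral_const_mul]
  rw [abs_of_pos (by positivity : 0 < 1 / π)]
  gcongr
  exact integral_abs_convolution_le hper' hu' hR

/-! ### Steklov means -/

/-- Locally integrable `2π`-periodic functions with `‖f(· + h) - f‖₁ ≤ C |h|`, where the `L¹` norm is
not normalized. -/
structure IsPeriodicLip (C : ℝ) (f : ℝ → ℝ) : Prop where
  periodic : Function.Periodic f (2 * π)
  intervalIntegrable : ∀ a b, IntervalIntegrable f volume a b
  integral_abs_le : ∀ h, ∫ x in (0 : ℝ)..(2 * π), |f (x + h) - f x| ≤ C * |h|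

/-- The Steklov mean `x ↦ (1/h) ∫_0^h f(x+s) ds`. -/
noncomputable def steklovMean (h : ℝ) (f : ℝ → ℝ) (x : ℝ) : ℝ :=
  1 / h * ∫ s in (0 : ℝ)..h, f (x + s)

lemma integrableOn_comp_add {f : ℝ → ℝ} (hf : ∀ a b, IntervalIntegrable f volume a b)
    (a b c d : ℝ) :
    IntegrableOn (fun p : ℝ × ℝ => f (p.1 + p.2)) (Set.uIoc a b ×ˢ Set.uIoc c d) := by
  set M : ℝ := |a| + |b| + |c| + |d| with hM
  have hM0 : 0 ≤ M := by positivity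
  have habs : ∀ {a b x : ℝ}, x ∈ Set.uIoc a b → |x| ≤ |a| + |b| := by
    intro a b x hx
    rcases Set.mem_uIoc.1 hx with h | h <;> rw [abs_le] <;> constructor <;>
      linarith [abs_nonneg a, abs_nonneg b, le_abs_self a, le_abs_self b, neg_abs_le a,
        neg_abs_le b]
  have hφ : Integrable ((Set.Icc (-M) M).indicator f) := by
    rw [integrable_indicator_iff measurableSet_Icc]
    exact (intervalIntegrable_iff_integrableOn_Icc_of_le (by linarith)).1 (hf _ _)
  have hψ : Integrable ((Set.uIoc a b).indicator fun _ : ℝ => (1 : ℝ)) := by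
    rw [integrable_indicator_iff measurableSet_uIoc]
    exact intervalIntegrable_iff.1 intervalIntegrable_const
  have hprod := (measurePreserving_prod_add (volume : Measure ℝ) (volume : Measure ℝ)).integrable_comp
    (hψ.mul_prod hφ).aestronglyMeasurable |>.2 (hψ.mul_prod hφ)
  refine IntegrableOn.congr_fun hprod.integrableOn ?_ (measurableSet_uIoc.prod measurableSet_uIoc)
  rintro ⟨x, s⟩ ⟨hx, hs⟩
  simp only at hx hs
  have hxs : x + s ∈ Set.Icc (-M) M := by
    refine abs_le.1 ((abs_add_le x s).trans ?_)
    rw [hM]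
    linarith [habs hx, habs hs]
  simp [Set.indicator_of_mem hx, Set.indicator_of_mem hxs]

lemma integral_abs_average_le {F : ℝ → ℝ → ℝ} {T h B : ℝ} (hT : 0 ≤ T) (hh : 0 < h)
    (hF : IntegrableOn (Function.uncurry F) (Set.uIoc 0 T ×ˢ Set.uIoc 0 h))
    (hB : ∀ s ∈ Set.Ioc 0 h, ∫ x in (0 : ℝ)..T, |F x s| ≤ B) :
    ∫ x in (0 : ℝ)..T, |1 / h * ∫ s in (0 : ℝ)..h, F x s| ≤ B := by
  simp only [abs_mul, intervalIntegral.integral_const_mul, abs_of_pos (one_div_pos.2 hh)]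
  rw [Set.uIoc_of_le hT, Set.uIoc_of_le hh.le, IntegrableOn, Measure.volume_eq_prod,
    ← Measure.prod_restrict] at hF
  simp only [intervalIntegral.integral_of_le hT, intervalIntegral.integral_of_le hh.le] at hB ⊢
  have h1 : ∫ x in Set.Ioc 0 T, |∫ s in Set.Ioc 0 h, F x s| ≤
      ∫ x in Set.Ioc 0 T, ∫ s in Set.Ioc 0 h, |F x s| :=
    integral_mono hF.integral_prod_left.abs hF.integral_norm_prod_left
      fun x => abs_integral_le_integral_abs
  have h2 : ∫ x in Set.Ioc 0 T, ∫ s in Set.Ioc 0 h, |F x s| =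
      ∫ s in Set.Ioc 0 h, ∫ x in Set.Ioc 0 T, |F x s| :=
    integral_integral_swap (f := fun x s => |F x s|) hF.abs
  have h3 : ∫ s in Set.Ioc 0 h, ∫ x in Set.Ioc 0 T, |F x s| ≤ ∫ s in Set.Ioc 0 h, B :=
    setIntegral_mono_on hF.integral_norm_prod_right (by simp) measurableSet_Ioc hB
  have h4 : ∫ s in Set.Ioc 0 h, B = h * B := by simp [hh.le]
  rw [one_div, inv_mul_le_iff₀ hh]
  linarith

namespace IsPeriodicLip

variable {C h : ℝ} {f : ℝ → ℝ}

lemma intervalIntegrable_comp_add (hf : IsPeriodicLip C f) (x a b : ℝ) :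
    IntervalIntegrable (fun s => f (x + s)) volume a b := by
  have := (hf.intervalIntegrable (x + a) (x + b)).comp_add_left x
  simpa using this

lemma steklovMean_eq (hf : IsPeriodicLip C f) (x : ℝ) :
    steklovMean h f x = 1 / h * ((∫ s in (0 : ℝ)..(x + h), f s) - ∫ s in (0 : ℝ)..x, f s) := by
  unfold steklovMean
  rw [intervalIntegral.integral_comp_add_left (fun s => f s), add_zero,
    intervalIntegral.integral_interval_sub_left (hf.intervalIntegrable _ _)
      (hf.intervalIntegrable _ _)]

lemma continuous_steklovMean (hf : IsPeriodicLip C f) : Continuous (steklovMean h f) := by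
  have hF := intervalIntegral.continuous_primitive hf.intervalIntegrable 0
  have : steklovMean h f =
      fun x => 1 / h * ((∫ s in (0 : ℝ)..(x + h), f s) - ∫ s in (0 : ℝ)..x, f s) :=
    funext hf.steklovMean_eq
  rw [this]
  exact continuous_const.mul ((hF.comp (continuous_id.add continuous_const)).sub hF)

lemma hasDerivAt_steklovMean (hf : IsPeriodicLip C f) (hc : Continuous f) (x : ℝ) :
    HasDerivAt (steklovMean h f) (1 / h * (f (x + h) - f x)) x := by
  have : steklovMean h f =
      fun x => 1 / h * ((∫ s in (0 : ℝ)..(x + h), f s) - ∫ s in (0 : ℝ)..x, f s) :=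
    funext hf.steklovMean_eq
  rw [this]
  have h1 := hc.integral_hasStrictDerivAt 0 x |>.hasDerivAt
  have h2 := (hc.integral_hasStrictDerivAt 0 (x + h)).hasDerivAt.comp_add_const x h
  exact (h2.sub h1).const_mul _

lemma integrableOn_comp_add_sub (hf : IsPeriodicLip C f) (τ T : ℝ) :
    IntegrableOn (Function.uncurry fun x s => f (x + τ + s) - f (x + s))
      (Set.uIoc 0 T ×ˢ Set.uIoc 0 h) := by
  refine Integrable.sub ?_ (integrableOn_comp_add hf.intervalIntegrable _ _ _ _)
  have hg : ∀ a b, IntervalIntegrable (fun x => f (τ + x)) volume a b :=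
    hf.intervalIntegrable_comp_add τ
  refine (integrableOn_comp_add hg 0 T 0 h).congr (Filter.Eventually.of_forall fun p => ?_)
  simp only
  congr 1
  ring

lemma integral_abs_shift_le (hf : IsPeriodicLip C f) (τ s : ℝ) :
    ∫ x in (0 : ℝ)..(2 * π), |f (x + τ + s) - f (x + s)| ≤ C * |τ| := by
  have hp : Function.Periodic (fun x => f (x + τ) - f x) (2 * π) := fun x => by
    simp only [hf.periodic x, add_right_comm x (2 * π) τ, hf.periodic (x + τ)]
  have := integral_abs_comp_sub_left hp (-s)
  simp only [sub_neg_eq_add, add_right_comm _ s τ] at this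
  rw [this]
  exact hf.integral_abs_le τ

lemma isPeriodicLip_steklovMean (hf : IsPeriodicLip C f) (hh : 0 < h) :
    IsPeriodicLip C (steklovMean h f) where
  periodic x := by
    unfold steklovMean
    simp only [add_right_comm x (2 * π), hf.periodic _]
  intervalIntegrable a b := hf.continuous_steklovMean.intervalIntegrable a b
  integral_abs_le τ := by
    have e : ∀ x, steklovMean h f (x + τ) - steklovMean h f x =
        1 / h * ∫ s in (0 : ℝ)..h, (f (x + τ + s) - f (x + s)) := fun x => by
      unfold steklovMean
      rw [intervalIntegral.integral_sub (hf.intervalIntegrable_comp_add _ _ _)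
        (hf.intervalIntegrable_comp_add _ _ _), mul_sub]
    simp only [e]
    exact integral_abs_average_le Real.two_pi_pos.le hh (hf.integrableOn_comp_add_sub τ _)
      fun s _ => hf.integral_abs_shift_le τ s

lemma integral_abs_steklovMean_sub_le (hf : IsPeriodicLip C f) (hC : 0 ≤ C) (hh : 0 < h) :
    ∫ x in (0 : ℝ)..(2 * π), |steklovMean h f x - f x| ≤ C * h := by
  have e : ∀ x, steklovMean h f x - f x =
      1 / h * ∫ s in (0 : ℝ)..h, (f (x + s) - f x) := fun x => by
    unfold steklovMean
    rw [intervalIntegral.integral_sub (hf.intervalIntegrable_comp_add _ _ _)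
      intervalIntegrable_const, intervalIntegral.integral_const, smul_eq_mul]
    field_simp
    ring
  simp only [e]
  refine integral_abs_average_le Real.two_pi_pos.le hh ?_ fun s hs => ?_
  · refine Integrable.sub (integrableOn_comp_add hf.intervalIntegrable _ _ _ _) ?_
    rw [Measure.volume_eq_prod, ← Measure.prod_restrict]
    have h1 : Integrable f (volume.restrict (Set.uIoc 0 (2 * π))) :=
      intervalIntegrable_iff.1 (hf.intervalIntegrable _ _)
    have h2 : Integrable (fun _ : ℝ => (1 : ℝ)) (volume.restrict (Set.uIoc 0 h)) :=
      intervalIntegrable_iff.1 intervalIntegrable_const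
    simpa using h1.mul_prod h2
  · refine (hf.integral_abs_le s).trans ?_
    rw [abs_of_pos hs.1]
    gcongr
    exact hs.2

end IsPeriodicLip

lemma LipClass.exists_isPeriodicLip {f : ℝ → ℝ} (hf : LipClass 1 1 f) :
    ∃ C, 0 ≤ C ∧ IsPeriodicLip C f := by
  obtain ⟨hper, hint, -, C, hC, hω⟩ := hf
  have hpi := Real.two_pi_pos
  have hloc : ∀ a b, IntervalIntegrable f volume a b := hper.intervalIntegrable₀ hpi.ne' hint
  have hshift : ∀ h, IntervalIntegrable (fun x => f (x + h)) volume 0 (2 * π) := fun h => by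
    have := (hloc (0 + h) (2 * π + h)).comp_add_right h
    simpa using this
  have hbdd : ∀ h, ∫ x in (0 : ℝ)..(2 * π), |f (x + h) - f x| ≤
      2 * ∫ x in (0 : ℝ)..(2 * π), |f x| := by
    intro h
    have e := integral_abs_comp_sub_left hper (-h)
    simp only [sub_neg_eq_add] at e
    calc _ ≤ ∫ x in (0 : ℝ)..(2 * π), (|f (x + h)| + |f x|) :=
          intervalIntegral.integral_mono hpi.le ((hshift h).sub hint).abs
            ((hshift h).abs.add hint.abs) fun x => abs_sub _ _
      _ = _ := by
          rw [intervalIntegral.integral_add (hshift h).abs hint.abs, e]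
          ring
  refine ⟨2 * π * C, by positivity, hper, hloc, fun h => ?_⟩
  rcases eq_or_ne h 0 with rfl | hh
  · simp
  have hh' : 0 < |h| := abs_pos.2 hh
  have h1 := hω |h| hh'
  have h2 : 1 / (2 * π) * ∫ x in (0 : ℝ)..(2 * π), |f (x + h) - f x| ≤ intModulus 1 f |h| := by
    refine le_csSup ⟨1 / (2 * π) * (2 * ∫ x in (0 : ℝ)..(2 * π), |f x|), ?_⟩
      ⟨h, hh', le_rfl, by simp⟩
    rintro y ⟨h', -, -, rfl⟩
    simp only [Real.rpow_one, div_one]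
    gcongr
    exact hbdd h'
  rw [Real.rpow_one] at h1
  have h3 := h2.trans h1
  rw [one_div, inv_mul_le_iff₀ hpi] at h3
  linarith

/-! ### Matrix means -/

lemma abs_dirichletKernel_le (k : ℕ) (u : ℝ) : |dirichletKernel k u| ≤ (k : ℝ) + 1 := by
  unfold dirichletKernel
  refine (abs_add_le _ _).trans ?_
  have h1 : |∑ j ∈ Finset.Icc 1 k, Real.cos (j * u)| ≤ k := by
    refine (Finset.abs_sum_le_sum_abs _ _).trans ?_
    refine (Finset.sum_le_card_nsmul _ _ 1 fun j _ => Real.abs_cos_le_one _).trans ?_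
    simp
  have h2 : |(1 / 2 : ℝ)| ≤ 1 := by norm_num [abs_le]
  linarith

lemma intervalIntegrable_mul_dirichletKernel {g : ℝ → ℝ}
    (hg : IntervalIntegrable g volume 0 (2 * π)) (k : ℕ) (x : ℝ) :
    IntervalIntegrable (fun t => g t * dirichletKernel k (x - t)) volume 0 (2 * π) :=
  hg.mul_continuousOn
    ((continuous_dirichletKernel k).comp (continuous_const.sub continuous_id)).continuousOn

lemma matrixMeans_sub {f g : ℝ → ℝ} (hf : IntervalIntegrable f volume 0 (2 * π))
    (hg : IntervalIntegrable g volume 0 (2 * π)) (a : ℕ → ℕ → ℝ) (n : ℕ) (x : ℝ) :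
    matrixMeans a (fun t => f t - g t) n x = matrixMeans a f n x - matrixMeans a g n x := by
  unfold matrixMeans partialFourierSum
  rw [← Finset.sum_sub_distrib]
  refine Finset.sum_congr rfl fun k _ => ?_
  simp only [sub_mul]
  rw [intervalIntegral.integral_sub (intervalIntegrable_mul_dirichletKernel hf k x)
    (intervalIntegrable_mul_dirichletKernel hg k x)]
  ring

lemma continuous_matrixMeans {g : ℝ → ℝ} (hg : IntervalIntegrable g volume 0 (2 * π))
    (a : ℕ → ℕ → ℝ) (n : ℕ) : Continuous (matrixMeans a g n) := by
  unfold matrixMeans partialFourierSum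
  refine continuous_finsetSum _ fun k _ => continuous_const.mul (continuous_const.mul ?_)
  refine intervalIntegral.continuous_of_dominated_interval
    (bound := fun t => |g t| * ((k : ℝ) + 1))
    (fun x => (intervalIntegrable_iff.1
      (intervalIntegrable_mul_dirichletKernel hg k x)).aestronglyMeasurable)
    (fun x => Filter.Eventually.of_forall fun t _ => ?_) (hg.abs.mul_const _)
    (Filter.Eventually.of_forall fun t _ => continuous_const.mul
      ((continuous_dirichletKernel k).comp (continuous_id.sub continuous_const)))
  rw [Real.norm_eq_abs, abs_mul]
  gcongr
  exact abs_dirichletKernel_le k _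

lemma abs_matrixMeans_le {g : ℝ → ℝ} (hg : IntervalIntegrable g volume 0 (2 * π))
    (a : ℕ → ℕ → ℝ) (n : ℕ) (ha : ∀ k ≤ n, 0 ≤ a n k)
    (hsum : ∑ k ∈ Finset.range (n + 1), a n k = 1) (x : ℝ) :
    |matrixMeans a g n x| ≤ 1 / π * (((n : ℝ) + 1) * ∫ t in (0 : ℝ)..(2 * π), |g t|) := by
  have hpi := Real.pi_pos
  set B := 1 / π * (((n : ℝ) + 1) * ∫ t in (0 : ℝ)..(2 * π), |g t|) with hB
  have hS : ∀ k ≤ n, |partialFourierSum g k x| ≤ B := by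
    intro k hk
    unfold partialFourierSum
    rw [abs_mul, abs_of_pos (by positivity : 0 < 1 / π), hB]
    gcongr
    refine (intervalIntegral.abs_integral_le_integral_abs Real.two_pi_pos.le).trans ?_
    rw [← intervalIntegral.integral_const_mul]
    refine intervalIntegral.integral_mono Real.two_pi_pos.le
      (intervalIntegrable_mul_dirichletKernel hg k x).abs (hg.abs.const_mul _) fun t => ?_
    simp only [abs_mul]
    rw [mul_comm]
    have : (k : ℝ) ≤ n := by exact_mod_cast hk
    gcongr
    exact (abs_dirichletKernel_le k _).trans (by linarith)
  unfold matrixMeans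
  calc _ ≤ ∑ k ∈ Finset.range (n + 1), a n k * B := by
        refine (Finset.abs_sum_le_sum_abs _ _).trans (Finset.sum_le_sum fun k hk => ?_)
        have hkn := Finset.mem_range_succ_iff.1 hk
        rw [abs_mul, abs_of_nonneg (ha k hkn)]
        exact mul_le_mul_of_nonneg_left (hS k hkn) (ha k hkn)
    _ = B := by rw [← Finset.sum_mul, hsum, one_mul]

lemma integral_abs_matrixMeans_le {g : ℝ → ℝ} (hg : IntervalIntegrable g volume 0 (2 * π))
    (a : ℕ → ℕ → ℝ) (n : ℕ) (ha : ∀ k ≤ n, 0 ≤ a n k)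
    (hsum : ∑ k ∈ Finset.range (n + 1), a n k = 1) :
    ∫ x in (0 : ℝ)..(2 * π), |matrixMeans a g n x| ≤
      2 * ((n : ℝ) + 1) * ∫ t in (0 : ℝ)..(2 * π), |g t| := by
  have hpi := Real.pi_pos
  refine (intervalIntegral.integral_mono Real.two_pi_pos.le
    ((continuous_matrixMeans hg a n).abs.intervalIntegrable _ _) intervalIntegrable_const
    fun x => abs_matrixMeans_le hg a n ha hsum x).trans (le_of_eq ?_)
  rw [intervalIntegral.integral_const, smul_eq_mul]
  field_simp
  ring

/-- For `f ∈ Lip(1,1)` the `L¹` error of the matrix means is controlled by the `L¹` norm of the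
corresponding combination of sawtooth remainders. -/
lemma IsPeriodicLip.integral_abs_matrixMeans_sub_le {C : ℝ} {f : ℝ → ℝ} (hf : IsPeriodicLip C f)
    (hC : 0 ≤ C) (a : ℕ → ℕ → ℝ) (n : ℕ) (ha : ∀ k ≤ n, 0 ≤ a n k)
    (hsum : ∑ k ∈ Finset.range (n + 1), a n k = 1) :
    ∫ x in (0 : ℝ)..(2 * π), |matrixMeans a f n x - f x| ≤
      1 / π * (C * ∫ s in (0 : ℝ)..(2 * π),
        |∑ k ∈ Finset.range (n + 1), a n k * sawtoothRemainder k s|) := by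
  have hpi := Real.pi_pos
  set I := ∫ s in (0 : ℝ)..(2 * π),
    |∑ k ∈ Finset.range (n + 1), a n k * sawtoothRemainder k s| with hI
  have hI0 : 0 ≤ I :=
    intervalIntegral.integral_nonneg Real.two_pi_pos.le fun _ _ => abs_nonneg _
  have key : ∀ h : ℝ, 0 < h → ∫ x in (0 : ℝ)..(2 * π), |matrixMeans a f n x - f x| ≤
      1 / π * (C * I) + (2 * ((n : ℝ) + 1) + 1) * (2 * C) * h := by
    intro h hh
    have hv := hf.isPeriodicLip_steklovMean hh
    have hvc : Continuous (steklovMean h f) := hf.continuous_steklovMean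
    have hu := hv.isPeriodicLip_steklovMean hh
    have huc : Continuous (steklovMean h (steklovMean h f)) := hv.continuous_steklovMean
    set v := steklovMean h f with hvdef
    set u := steklovMean h v with hudef
    have hfi := hf.intervalIntegrable 0 (2 * π)
    have hui := hu.intervalIntegrable 0 (2 * π)
    have hvi := hv.intervalIntegrable 0 (2 * π)
    have hfu : ∫ x in (0 : ℝ)..(2 * π), |f x - u x| ≤ 2 * C * h := by
      calc _ ≤ ∫ x in (0 : ℝ)..(2 * π), (|v x - f x| + |u x - v x|) := by
            refine intervalIntegral.integral_mono Real.two_pi_pos.le (hfi.sub hui).abs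
              ((hvi.sub hfi).abs.add (hui.sub hvi).abs) fun x => ?_
            simp only
            rw [abs_sub_comm (v x), abs_sub_comm (u x)]
            exact abs_sub_le _ _ _
        _ ≤ C * h + C * h := by
            rw [intervalIntegral.integral_add (hvi.sub hfi).abs (hui.sub hvi).abs]
            exact add_le_add (hf.integral_abs_steklovMean_sub_le hC hh)
              (hv.integral_abs_steklovMean_sub_le hC hh)
        _ = 2 * C * h := by ring
    have hu'c : Continuous fun x => 1 / h * (v (x + h) - v x) := by fun_prop
    have hu'p : Function.Periodic (fun x => 1 / h * (v (x + h) - v x)) (2 * π) := fun x => by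
      simp only [hv.periodic x, add_right_comm x (2 * π) h, hv.periodic (x + h)]
    have hu'n : ∫ x in (0 : ℝ)..(2 * π), |1 / h * (v (x + h) - v x)| ≤ C := by
      simp only [abs_mul, intervalIntegral.integral_const_mul, abs_of_pos (one_div_pos.2 hh)]
      rw [one_div, inv_mul_le_iff₀ hh]
      have := hv.integral_abs_le h
      rw [abs_of_pos hh] at this
      linarith
    have hTu : ∫ x in (0 : ℝ)..(2 * π), |matrixMeans a u n x - u x| ≤ 1 / π * (C * I) := by
      refine (integral_abs_matrixMeans_sub_le_of_hasDerivAt hu.periodic hu'p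
        (fun x => hv.hasDerivAt_steklovMean hvc x) hu'c a n hsum).trans ?_
      gcongr
    have hTfu := integral_abs_matrixMeans_le (hfi.sub hui) a n ha hsum
    have hc1 : IntervalIntegrable (fun x => |matrixMeans a (fun t => f t - u t) n x|) volume
        0 (2 * π) := (continuous_matrixMeans (hfi.sub hui) a n).abs.intervalIntegrable _ _
    have hc2 : IntervalIntegrable (fun x => |matrixMeans a u n x - u x|) volume 0 (2 * π) :=
      ((continuous_matrixMeans hui a n).sub huc).abs.intervalIntegrable _ _
    have hc3 : IntervalIntegrable (fun x => |matrixMeans a f n x - f x|) volume 0 (2 * π) :=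
      (((continuous_matrixMeans hfi a n).intervalIntegrable _ _).sub hfi).abs
    have htri : ∫ x in (0 : ℝ)..(2 * π), |matrixMeans a f n x - f x| ≤
        ∫ x in (0 : ℝ)..(2 * π), (|matrixMeans a (fun t => f t - u t) n x| +
          |matrixMeans a u n x - u x| + |f x - u x|) := by
      refine intervalIntegral.integral_mono Real.two_pi_pos.le hc3
        ((hc1.add hc2).add (hfi.sub hui).abs) fun x => ?_
      simp only [matrixMeans_sub hfi hui]
      have e : matrixMeans a f n x - f x = (matrixMeans a f n x - matrixMeans a u n x) +
          (matrixMeans a u n x - u x) + (u x - f x) := by ring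
      rw [e, abs_sub_comm (f x)]
      exact abs_add_three _ _ _
    rw [intervalIntegral.integral_add (hc1.add hc2) (hfi.sub hui).abs,
      intervalIntegral.integral_add hc1 hc2] at htri
    have hTfu' : 2 * ((n : ℝ) + 1) * ∫ x in (0 : ℝ)..(2 * π), |f x - u x| ≤
        2 * ((n : ℝ) + 1) * (2 * C * h) := by gcongr
    linarith
  refine le_of_forall_pos_le_add fun ε hε => ?_
  set D := (2 * ((n : ℝ) + 1) + 1) * (2 * C) with hD
  have hD0 : 0 ≤ D := by positivity
  refine (key (ε / (D + 1)) (by positivity)).trans ?_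
  have : D * (ε / (D + 1)) ≤ ε := by
    rw [← mul_div_assoc, div_le_iff₀ (by positivity)]
    nlinarith
  linarith

/-- Theorem 5 (vi): if `f ∈ Lip(1,1)`, the matrix is nonnegative, lower
triangular with row sums `1`, for some `β > 0` the sequences `((k+1)^{-β} a_{n,k})`
are in `HBVS` with a constant independent of `n`, and `(n+1)a_{n,n} = O(1)`, then
`‖T_n(f) - f‖_{L^1} = O(n^{-1})`. -/
theorem trig_approx_HBVS (f : ℝ → ℝ) (hf : LipClass 1 1 f)
    (a : ℕ → ℕ → ℝ)
    (hpos : ∀ n k, k ≤ n → 0 ≤ a n k)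
    (hzero : ∀ n k, n < k → a n k = 0)
    (hsum : ∀ n, ∑ k ∈ Finset.range (n + 1), a n k = 1)
    (β : ℝ) (hβ : 0 < β)
    (hHBVS : ∃ K : ℝ, ∀ n m : ℕ, m ≤ n →
      ∑ k ∈ Finset.range m,
        |((k : ℝ) + 1) ^ (-β) * a n k - ((k : ℝ) + 2) ^ (-β) * a n (k + 1)| ≤
          K * (((m : ℝ) + 1) ^ (-β) * a n m))
    (hO : ∃ C : ℝ, ∀ n : ℕ, ((n : ℝ) + 1) * a n n ≤ C) :
    ∃ C : ℝ, ∀ n : ℕ, 1 ≤ n →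
      lpNorm 1 (fun x => matrixMeans a f n x - f x) ≤ C / (n : ℝ) := by
  obtain ⟨C, hC, hLip⟩ := hf.exists_isPeriodicLip
  obtain ⟨K, hK⟩ := hHBVS
  obtain ⟨A, hA⟩ := hO
  have hpi := Real.pi_pos
  set M : ℝ := 6 * π ^ 3 * (1 + (|K| + (1 + |K|) * (1 + 2 / β))) with hM
  have hM0 : 0 ≤ M := by positivity
  refine ⟨1 / (2 * π) * (1 / π * (C * (M * |A|))), fun n hn => ?_⟩
  have hn0 : (0 : ℝ) < n := by exact_mod_cast hn
  have hann : 0 ≤ a n n := hpos n n le_rfl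
  have hker := integral_abs_sum_mul_sawtoothRemainder_le (K := |K|) hβ (a n) n (hpos n)
    ((hK n n le_rfl).trans (mul_le_mul_of_nonneg_right (le_abs_self K)
      (mul_nonneg (Real.rpow_nonneg (by positivity) _) hann)))
  have hlast : a n n ≤ |A| / n := by
    rw [le_div_iff₀ hn0]
    linarith [hA n, le_abs_self A]
  have hmain := hLip.integral_abs_matrixMeans_sub_le hC a n (hpos n) (hsum n)
  unfold _root_.lpNorm
  simp only [Real.rpow_one, div_one]
  calc _ ≤ 1 / (2 * π) * (1 / π * (C * (M * (|A| / n)))) := by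
        gcongr
        refine hmain.trans ?_
        gcongr
        exact hker.trans (mul_le_mul_of_nonneg_left hlast hM0)
    _ = _ := by ring
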